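/- For every integer q ≥ 1 there exist nonzero elements c, d of Λ₄ such that Ψ_T^{2q} = c·1 + d·(w₃·w₄) in Q. (In the paper's language: Ψ_T^{2q} lies in the Λ-span of (11 1̄1̄) and (11 0̄0̄), with both coordinates nonvanishing.) -/

import Mathlib

/- Λ₄ is the group algebra of ℝ⁴ over ℝ; `E β` is the Novikov monomial e^β,
   δ i the standard basis vectors of ℝ⁴.  `Q` is the Künneth model of the
   quantum homology of M = (S²×S²)×(S²×S²) with form (ω₀⊕λω₀)⊕(−ω₀⊕−λω₀):
   the quotient of Λ₄[U₁,U₂,U₃,U₄] by U₁²−e^{−δ₁}, U₂²−e^{−δ₂}, U₃²−e^{δ₃},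
   U₄²−e^{δ₄}; `u i` are the images of the variables (u₁,u₂,w₃,w₄). -/

noncomputable section

abbrev Λ₄ : Type := AddMonoidAlgebra ℝ (Fin 4 → ℝ)

def E (β : Fin 4 → ℝ) : Λ₄ := AddMonoidAlgebra.single β 1

def δ (i : Fin 4) : Fin 4 → ℝ := Pi.single i 1

def qRel : Ideal (MvPolynomial (Fin 4) Λ₄) :=
  Ideal.span {MvPolynomial.X 0 ^ 2 - MvPolynomial.C (E (-δ 0)),
              MvPolynomial.X 1 ^ 2 - MvPolynomial.C (E (-δ 1)),
              MvPolynomial.X 2 ^ 2 - MvPolynomial.C (E (δ 2)),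
              MvPolynomial.X 3 ^ 2 - MvPolynomial.C (E (δ 3))}

abbrev Q : Type := MvPolynomial (Fin 4) Λ₄ ⧸ qRel

def u (i : Fin 4) : Q := Ideal.Quotient.mk qRel (MvPolynomial.X i)

def eQ (β : Fin 4 → ℝ) : Q := algebraMap Λ₄ Q (E β)

/-- Ψ_S = (u₁+u₂)·e^{(1/2+h)δ₁−hδ₂} -/
def ΨS (h : ℝ) : Q := (u 0 + u 1) * eQ ((1 / 2 + h) • δ 0 - h • δ 1)

/-- Ψ_T = −(w₃+w₄)·e^{−(1/2+h)δ₃+hδ₄} -/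
def ΨT (h : ℝ) : Q := -((u 2 + u 3) * eQ (-((1 / 2 + h) • δ 2) + h • δ 3))

/-- Ψ_{S'} = (u₁−w₄)·e^{(1/2+h)δ₁+hδ₄} -/
def ΨS' (h : ℝ) : Q := (u 0 - u 3) * eQ ((1 / 2 + h) • δ 0 + h • δ 3)

/-- Ψ_{T'} = (u₂−w₃)·e^{−(1/2+h)δ₃−hδ₂} -/
def ΨT' (h : ℝ) : Q := (u 1 - u 2) * eQ (-((1 / 2 + h) • δ 2) - h • δ 1)

/-- The augmentation of the group algebra, sending every monomial to `1`. -/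
def augmentation : Λ₄ →ₐ[ℝ] ℝ :=
  AddMonoidAlgebra.lift ℝ ℝ (Fin 4 → ℝ) 1

lemma augmentation_E (β : Fin 4 → ℝ) : augmentation (E β) = 1 := by
  simp [augmentation, E]

lemma u_two_sq : u 2 ^ 2 = algebraMap Λ₄ Q (E (δ 2)) :=
  Ideal.Quotient.eq.mpr (Ideal.subset_span (by simp))

lemma u_three_sq : u 3 ^ 2 = algebraMap Λ₄ Q (E (δ 3)) :=
  Ideal.Quotient.eq.mpr (Ideal.subset_span (by simp))

/-- Even powers of `-((x + y) * g)`, where `x²`, `y²` and `g` are scalars of positive image under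
a ring homomorphism `φ`, are combinations of `1` and `x * y` with coefficients of positive image. -/
lemma exists_pos_coords_neg_add_mul_pow {R S : Type*} [CommRing R] [CommRing S] [Algebra R S]
    (φ : R →+* ℝ) {a b g : R} (ha : 0 < φ a) (hb : 0 < φ b) (hg : 0 < φ g) {x y : S}
    (hx : x ^ 2 = algebraMap R S a) (hy : y ^ 2 = algebraMap R S b) {q : ℕ} (hq : 1 ≤ q) :
    ∃ c d : R, 0 < φ c ∧ 0 < φ d ∧
      (-((x + y) * algebraMap R S g)) ^ (2 * q) =
        algebraMap R S c + algebraMap R S d * (x * y) := by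
  induction q, hq using Nat.le_induction with
  | base =>
    refine ⟨g ^ 2 * (a + b), g ^ 2 * 2, ?_, ?_, ?_⟩
    · simp only [map_mul, map_add, map_pow]; positivity
    · simp only [map_mul, map_pow, map_ofNat]; positivity
    · simp only [map_mul, map_add, map_pow, map_ofNat, ← hx, ← hy]; ring
  | succ q _ ih =>
    obtain ⟨c, d, hc, hd, h⟩ := ih
    refine ⟨g ^ 2 * ((a + b) * c + 2 * (a * b) * d), g ^ 2 * (2 * c + (a + b) * d), ?_, ?_, ?_⟩
    · simp only [map_mul, map_add, map_pow, map_ofNat]; positivity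
    · simp only [map_mul, map_add, map_pow, map_ofNat]; positivity
    · rw [mul_add, pow_add, h]
      simp only [map_mul, map_add, map_pow, map_ofNat, ← hx, ← hy]; ring

/-- For every q ≥ 1, Ψ_T^{2q} = c·1 + d·(w₃·w₄) in Q with c, d nonzero in Λ₄. -/
theorem psiT_even_powers_two_nonzero_coords
    (lam : ℝ) (hlam : 1 < lam) (h : ℝ) (hh : h = 1 / (6 * lam * (lam - 1)))
    (q : ℕ) (hq : 1 ≤ q) :
    ∃ c d : Λ₄, c ≠ 0 ∧ d ≠ 0 ∧
      ΨT h ^ (2 * q) = algebraMap Λ₄ Q c * 1 + algebraMap Λ₄ Q d * (u 2 * u 3) := by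
  obtain ⟨c, d, hc, hd, hcd⟩ := exists_pos_coords_neg_add_mul_pow (augmentation : Λ₄ →+* ℝ)
    (S := Q) (a := E (δ 2)) (b := E (δ 3)) (g := E (-((1 / 2 + h) • δ 2) + h • δ 3))
    (by simp [augmentation_E]) (by simp [augmentation_E])
    (by simp [augmentation_E]) u_two_sq u_three_sq hq
  refine ⟨c, d, ?_, ?_, ?_⟩
  · rintro rfl
    simp at hc
  · rintro rfl
    simp at hd
  · rw [mul_one]
    exact hcd

end
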